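/- With demand d⁻ ≥ C and the constant speed limit u = v1 = C*w/(k_j*w − C), once the system is congested it converges to the dropped-capacity state: if k : [0,∞) → ℝ is differentiable, satisfies l0*k'(t) = F(v1, k(t)) − G(k(t)) for all t ≥ 0, and k(0) ∈ (k1, k_j], then k(t) ∈ (k1, k_j] for all t ≥ 0 and k(t) → k2 as t → ∞; consequently the discharging flow-rate is (1−Δ)C for all t and never recovers to C. -/

import Mathlib

/-- At the speed limit `v1 = C*w/(k_j*w − C)` the maximal controlled inflow equals `C`. -/
lemma speed_limit_capacity {w kj C : ℝ} (hw : 0 < w) (hkj : 0 < kj) (hC : C < kj * w) :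
    C * w / (kj * w - C) * w * kj / (C * w / (kj * w - C) + w) = C := by
  have h : w * kj - C ≠ 0 := by
    rw [mul_comm]
    exact (sub_pos.2 hC).ne'
  have hsum : C * w / (kj * w - C) + w = kj * w ^ 2 / (kj * w - C) := by
    field_simp
    ring
  rw [hsum]
  field_simp

/-- A function that decreases strictly whenever it meets the level `M` stays below `M`. -/
lemma le_of_deriv_neg_of_eq {f : ℝ → ℝ} (hf : Differentiable ℝ f) {M : ℝ} (h0 : f 0 ≤ M)
    (h : ∀ t, 0 ≤ t → f t = M → deriv f t < 0) {t : ℝ} (ht : 0 ≤ t) : f t ≤ M :=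
  image_le_of_deriv_right_lt_deriv_boundary (a := 0) (b := t) (B := fun _ => M)
    (B' := fun _ => 0) hf.continuous.continuousOn
    (fun x _ => (hf x).hasDerivAt.hasDerivWithinAt) h0 (fun x => hasDerivAt_const x M)
    (fun x hx => h x hx.1) ⟨ht, le_rfl⟩

/-- A function whose derivative pulls it towards `a` at least at linear rate `c > 0`
converges to `a`. -/
lemma tendsto_of_mul_deriv_le {f : ℝ → ℝ} (hf : Differentiable ℝ f) {a c : ℝ} (hc : 0 < c)
    (h : ∀ t, 0 ≤ t → (f t - a) * deriv f t ≤ -c * (f t - a) ^ 2) :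
    Filter.Tendsto f Filter.atTop (nhds a) := by
  have hder : ∀ t, HasDerivAt (fun s => (f s - a) ^ 2 * Real.exp (2 * c * s))
      ((2 * (f t - a) * deriv f t + 2 * c * (f t - a) ^ 2) * Real.exp (2 * c * t)) t := by
    intro t
    have h1 := (((hf t).hasDerivAt.sub_const a).fun_pow 2).fun_mul
      ((hasDerivAt_id t).const_mul (2 * c)).exp
    refine h1.congr_deriv ?_
    simp
    ring
  have hanti : AntitoneOn (fun s => (f s - a) ^ 2 * Real.exp (2 * c * s)) (Set.Ici 0) := by
    refine antitoneOn_of_deriv_nonpos (convex_Ici 0)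
      (fun t _ => (hder t).continuousAt.continuousWithinAt)
      (fun t _ => (hder t).differentiableAt.differentiableWithinAt) fun t ht => ?_
    rw [interior_Ici] at ht
    rw [(hder t).deriv]
    refine mul_nonpos_of_nonpos_of_nonneg ?_ (Real.exp_pos _).le
    linarith [h t (le_of_lt ht)]
  have hbound : ∀ t, 0 ≤ t → (f t - a) ^ 2 ≤ (f 0 - a) ^ 2 * Real.exp (-(2 * c * t)) := by
    intro t ht
    have h1 := hanti (Set.mem_Ici.2 le_rfl) (Set.mem_Ici.2 ht) ht
    simp only [mul_zero, Real.exp_zero, mul_one] at h1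
    rwa [Real.exp_neg, ← div_eq_mul_inv, le_div_iff₀ (Real.exp_pos _)]
  have hexp : Filter.Tendsto (fun t => (f 0 - a) ^ 2 * Real.exp (-(2 * c * t)))
      Filter.atTop (nhds 0) := by
    have h1 := (Real.tendsto_exp_neg_atTop_nhds_zero.comp
      (Filter.tendsto_id.const_mul_atTop (by positivity : 0 < 2 * c))).const_mul ((f 0 - a) ^ 2)
    simpa [Function.comp_def] using h1
  have hsq : Filter.Tendsto (fun t => (f t - a) ^ 2) Filter.atTop (nhds 0) :=
    squeeze_zero' (Filter.Eventually.of_forall fun t => sq_nonneg _)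
      ((Filter.eventually_ge_atTop 0).mono hbound) hexp
  have habs : Filter.Tendsto (fun t => |f t - a|) Filter.atTop (nhds 0) := by
    simpa [Real.sqrt_sq_eq_abs] using hsq.sqrt
  exact tendsto_sub_nhds_zero_iff.1 ((tendsto_zero_iff_abs_tendsto_zero _).2 habs)


/-- In-flux function of the link queue model:
`F(u,k) = min{d⁻, u*w*k_j/(u+w), w*(k_j−k)}`. -/
noncomputable def influx (dm w kj u k : ℝ) : ℝ :=
  min dm (min (u * w * kj / (u + w)) (w * (kj - k)))

/-- Out-flux (discharging flow-rate) with capacity drop: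
`G(k) = v_f*k` if `k ≤ k1 = C/v_f`, and `(1−Δ)*C` otherwise. -/
noncomputable def outflux (vf C Δ k : ℝ) : ℝ :=
  if k ≤ C / vf then vf * k else (1 - Δ) * C
/-- With demand `d⁻ ≥ C` and the constant speed limit `u = v1`, once the system is
congested it converges to the dropped-capacity state: a solution with
`k(0) ∈ (k1, k_j]` stays in `(k1, k_j]`, converges to `k2`, and its discharging
flow-rate is `(1−Δ)C` for all time. -/
theorem congested_state_converges_to_dropped_capacity
    (vf w kj C Δ dm l0 : ℝ)
    (hvf : 0 < vf) (hw : 0 < w) (hkj : 0 < kj)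
    (hC0 : 0 < C) (hCub : C < vf * w * kj / (vf + w))
    (hΔ0 : 0 < Δ) (hΔ1 : Δ < 1)
    (hl0 : 0 < l0) (hdm : C ≤ dm)
    (k : ℝ → ℝ) (hk : Differentiable ℝ k)
    (hode : ∀ t : ℝ, 0 ≤ t →
      l0 * deriv k t =
        influx dm w kj (C * w / (kj * w - C)) (k t) - outflux vf C Δ (k t))
    (hk0l : C / vf < k 0) (hk0u : k 0 ≤ kj) :
    (∀ t : ℝ, 0 ≤ t → C / vf < k t ∧ k t ≤ kj) ∧
    Filter.Tendsto k Filter.atTop (nhds (kj - (1 - Δ) * C / w)) ∧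
    (∀ t : ℝ, 0 ≤ t → outflux vf C Δ (k t) = (1 - Δ) * C) := by
  have hCk : C * (vf + w) < vf * w * kj := (lt_div_iff₀ (by positivity)).1 hCub
  have hCw : C < kj * w := by nlinarith [mul_pos hC0 hw]
  have hD : 0 < (1 - Δ) * C := mul_pos (by linarith) hC0
  have hΔC : 0 < Δ * C := mul_pos hΔ0 hC0
  have hin : ∀ x, influx dm w kj (C * w / (kj * w - C)) x = min C (w * (kj - x)) := by
    intro x
    rw [influx, speed_limit_capacity hw hkj hCw, ← min_assoc, min_eq_right hdm]
  have hout : ∀ x, C / vf < x → outflux vf C Δ x = (1 - Δ) * C :=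
    fun x hx => if_neg (not_le.2 hx)
  have hcong : ∀ t, 0 ≤ t → C / vf < k t →
      l0 * deriv k t = min C (w * (kj - k t)) - (1 - Δ) * C := by
    intro t ht h
    rw [hode t ht, hin, hout _ h]
  have hk1 : C / vf < kj - C / w := by
    rw [lt_sub_iff_add_lt, div_add_div _ _ hvf.ne' hw.ne', div_lt_iff₀ (by positivity)]
    linarith
  obtain ⟨m, hm1, hm2⟩ := exists_between (lt_min hk0l hk1)
  obtain ⟨hm0, hmc⟩ := lt_min_iff.1 hm2
  have hmw : C < w * (kj - m) := by
    have := (div_lt_iff₀ hw).1 (by linarith : C / w < kj - m)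
    linarith
  have hlow : ∀ t, 0 ≤ t → m ≤ k t := by
    intro t ht
    refine neg_le_neg_iff.1 (le_of_deriv_neg_of_eq (f := fun s => -k s) hk.fun_neg
      (neg_le_neg hm0.le) (fun s hs hsm => ?_) ht)
    have hsm' : k s = m := neg_injective hsm
    have h1 := hcong s hs (hsm' ▸ hm1)
    rw [hsm', min_eq_left hmw.le] at h1
    rw [deriv.fun_neg, neg_lt_zero]
    exact pos_of_mul_pos_right (by linarith : 0 < l0 * deriv k s) hl0.le
  have hk1t : ∀ t, 0 ≤ t → C / vf < k t := fun t ht => hm1.trans_le (hlow t ht)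
  have hup : ∀ t, 0 ≤ t → k t ≤ kj := by
    intro t ht
    refine le_of_deriv_neg_of_eq hk hk0u (fun s hs hsk => ?_) ht
    have h1 := hcong s hs (hk1t s hs)
    rw [hsk, sub_self, mul_zero, min_eq_right hC0.le] at h1
    exact neg_of_mul_neg_right (by linarith : l0 * deriv k s < 0) hl0.le
  refine ⟨fun t ht => ⟨hk1t t ht, hup t ht⟩, ?_, fun t ht => hout _ (hk1t t ht)⟩
  set k2 := kj - (1 - Δ) * C / w with hk2
  have hwk2 : w * k2 = w * kj - (1 - Δ) * C := by
    rw [hk2]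
    field_simp
  have he : 0 < k2 - m := by
    refine pos_of_mul_pos_right (?_ : 0 < w * (k2 - m)) hw.le
    linarith
  obtain ⟨c, hc0, hcw, hce⟩ : ∃ c, 0 < c ∧ c ≤ w ∧ c * (k2 - m) ≤ Δ * C :=
    ⟨min w (Δ * C / (k2 - m)), lt_min hw (div_pos hΔC he), min_le_left _ _,
      (le_div_iff₀ he).1 (min_le_right _ _)⟩
  refine tendsto_of_mul_deriv_le hk (div_pos hc0 hl0) fun t ht => ?_
  have h1 := hcong t ht (hk1t t ht)
  have hmt := hlow t ht
  suffices h : (k t - k2) * (l0 * deriv k t) ≤ -c * (k t - k2) ^ 2 by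
    have h2 : -(c / l0) * (k t - k2) ^ 2 = -c * (k t - k2) ^ 2 / l0 := by ring
    rw [h2, le_div_iff₀ hl0]
    linarith
  rcases le_total k2 (k t) with hge | hle
  · have h2 : l0 * deriv k t ≤ -c * (k t - k2) := by
      have := min_le_right C (w * (kj - k t))
      nlinarith [mul_nonneg (sub_nonneg.2 hcw) (sub_nonneg.2 hge)]
    nlinarith [mul_le_mul_of_nonneg_left h2 (sub_nonneg.2 hge)]
  · have h2 : c * (k2 - k t) ≤ l0 * deriv k t := by
      rw [h1, le_sub_iff_add_le]
      refine le_min ?_ ?_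
      · nlinarith [mul_le_mul_of_nonneg_left (sub_le_sub_left hmt k2) hc0.le]
      · nlinarith [mul_nonneg (sub_nonneg.2 hcw) (sub_nonneg.2 hle)]
    nlinarith [mul_le_mul_of_nonneg_left h2 (sub_nonneg.2 hle)]
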